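/- Let T be a forest. If T has no edges, then χ_ISC(T) = |V(T)|. Otherwise, let v be a stem in T, let R be the set of leaf neighbors of v, and let r = |R|. If r+1 is not a triangular number, then χ_ISC(T) = χ_ISC(T − R − v) + r + 1 + u_r; if r+1 is a triangular number, then χ_ISC(T) = χ_ISC(T − R) + r + u_r. -/

import Mathlib

variable {V : Type} [Fintype V] [DecidableEq V]

/-- The `k`-th triangular number `t_k = C(k+1,2)`. -/
def tri (k : ℕ) : ℕ := (k + 1).choose 2

/-- A natural number is triangular if it equals `t_k` for some `k`. -/
def IsTriangular (m : ℕ) : Prop := ∃ k, m = tri k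

/-- `uval r = max {k : t_k ≤ r}`. -/
def uval (r : ℕ) : ℕ := Nat.findGreatest (fun k => tri k ≤ r) r

/-- The lists `L` admit a proper coloring of the subgraph of `G` induced by `S`,
with each vertex of `S` colored from its list. -/
def ColorableOn (G : SimpleGraph V) (S : Finset V) (L : V → Finset ℕ) : Prop :=
  ∃ φ : V → ℕ, (∀ v ∈ S, φ v ∈ L v) ∧ ∀ x ∈ S, ∀ y ∈ S, G.Adj x y → φ x ≠ φ y

/-- In the interactive sum choice game on the subgraph of `G` induced by `S`, starting
from lists `L`, Requester can force the game to end within `n` further rounds: either the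
current lists already admit a proper coloring, or Requester can request a new color at
some vertex `v ∈ S` so that, whatever color `c ∉ L v` Supplier adds to `L v`, Requester
can finish within `n - 1` further rounds. -/
def ReqWins (G : SimpleGraph V) (S : Finset V) : (V → Finset ℕ) → ℕ → Prop
  | L, 0 => ColorableOn G S L
  | L, n + 1 => ColorableOn G S L ∨
      ∃ v ∈ S, ∀ c ∉ L v, ReqWins G S (Function.update L v (insert c (L v))) n

/-- The interactive sum choice number of the subgraph of `G` induced by `S`:
the optimal number of rounds of the interactive sum choice game, namely the least `n`
such that Requester can force the game, started from empty lists, to end within `n`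
rounds. -/
noncomputable def isc (G : SimpleGraph V) (S : Finset V) : ℕ :=
  sInf {n | ReqWins G S (fun _ => ∅) n}

/-- A vertex is a leaf if it has exactly one neighbor. -/
def IsLeaf (G : SimpleGraph V) (v : V) : Prop := (G.neighborSet v).ncard = 1

/-- A stem in a forest: a vertex with at least one leaf neighbor and at most one
non-leaf neighbor. -/
def IsStem (G : SimpleGraph V) (v : V) : Prop :=
  (∃ w, G.Adj v w ∧ IsLeaf G w) ∧ {w | G.Adj v w ∧ ¬ IsLeaf G w}.ncard ≤ 1

section

set_option linter.unusedSectionVars false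

open Finset

theorem tri_succ (k : ℕ) : tri (k + 1) = tri k + (k + 1) := by
  unfold tri
  rw [Nat.choose_succ_succ' (k + 1) 1, Nat.choose_one_right, one_add_one_eq_two]
  omega

theorem tri_zero : tri 0 = 0 := rfl

theorem tri_mono : Monotone tri :=
  monotone_nat_of_le_succ fun k => by rw [tri_succ]; omega

theorem le_tri (k : ℕ) : k ≤ tri k := by
  induction k with
  | zero => simp
  | succ k ih => rw [tri_succ]; omega

theorem tri_uval_le (r : ℕ) : tri (uval r) ≤ r :=
  Nat.findGreatest_spec (P := fun k => tri k ≤ r) (Nat.zero_le r) (Nat.zero_le r)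

theorem lt_tri_uval_succ (r : ℕ) : r < tri (uval r + 1) := by
  by_contra! h
  have h1 : uval r + 1 ≤ uval r :=
    Nat.le_findGreatest (P := fun k => tri k ≤ r) ((le_tri _).trans h) h
  omega

theorem isTriangular_succ_iff (r : ℕ) : IsTriangular (r + 1) ↔ r + 1 = tri (uval r + 1) := by
  refine ⟨fun ⟨K, hK⟩ => ?_, fun h => ⟨_, h⟩⟩
  have h1 := tri_uval_le r
  have h2 := lt_tri_uval_succ r
  have h3 : uval r < K := by
    by_contra! h
    have := tri_mono h
    omega
  have h4 : tri (uval r + 1) ≤ tri K := tri_mono h3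
  omega

/-! ### Basic properties of the game -/

section Game

variable {G : SimpleGraph V}

theorem ColorableOn.mono {S S' : Finset V} {L L' : V → Finset ℕ} (hS : S' ⊆ S)
    (h : ∀ x ∈ S', L x ⊆ L' x) (hc : ColorableOn G S L) : ColorableOn G S' L' := by
  obtain ⟨φ, h1, h2⟩ := hc
  exact ⟨φ, fun x hx => h x hx (h1 x (hS hx)), fun x hx y hy => h2 x (hS hx) y (hS hy)⟩

theorem ReqWins.of_colorable {S : Finset V} {L : V → Finset ℕ} (h : ColorableOn G S L) (n : ℕ) :
    ReqWins G S L n := by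
  cases n with
  | zero => exact h
  | succ n => exact Or.inl h

theorem ReqWins.succ {S : Finset V} {L : V → Finset ℕ} {n : ℕ} (h : ReqWins G S L n) :
    ReqWins G S L (n + 1) := by
  induction n generalizing L with
  | zero => exact Or.inl h
  | succ n ih =>
    rcases h with h | ⟨x, hx, h⟩
    · exact Or.inl h
    · exact Or.inr ⟨x, hx, fun c hc => ih (h c hc)⟩

theorem ReqWins.of_le {S : Finset V} {L : V → Finset ℕ} {n m : ℕ} (h : ReqWins G S L n)
    (hnm : n ≤ m) : ReqWins G S L m := by
  induction hnm with
  | refl => exact h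
  | step _ ih => exact ih.succ

/-- Enlarging lists, and restricting to a smaller vertex set, only helps Requester. -/
theorem ReqWins.mono {S S' : Finset V} {L L' : V → Finset ℕ} {n : ℕ} (hS : S' ⊆ S)
    (hL : ∀ x ∈ S', L x ⊆ L' x) (h : ReqWins G S L n) : ReqWins G S' L' n := by
  induction n generalizing L L' with
  | zero => exact ColorableOn.mono hS hL h
  | succ n ih =>
    rcases h with h | ⟨x, hx, h⟩
    · exact Or.inl (ColorableOn.mono hS hL h)
    by_cases hx' : x ∈ S'
    · refine Or.inr ⟨x, hx', fun c hc => ih ?_ (h c fun hc' => hc (hL x hx' hc'))⟩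
      intro y hy
      rcases eq_or_ne y x with rfl | hyx
      · simpa using insert_subset_insert c (hL y hy)
      · simpa [hyx] using hL y hy
    · obtain ⟨c, hc⟩ := Infinite.exists_notMem_finset (L x)
      refine (ih ?_ (h c hc)).succ
      intro y hy
      have hyx : y ≠ x := fun e => hx' (e ▸ hy)
      simpa [hyx] using hL y hy

/-- Permuting the colors does not affect the game. -/
theorem ReqWins.map_perm {S : Finset V} {L : V → Finset ℕ} {n : ℕ} (σ : Equiv.Perm ℕ)
    (h : ReqWins G S L n) : ReqWins G S (fun x => (L x).map σ.toEmbedding) n := by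
  have hcol : ∀ {L : V → Finset ℕ}, ColorableOn G S L →
      ColorableOn G S (fun x => (L x).map σ.toEmbedding) := by
    rintro L ⟨φ, h1, h2⟩
    refine ⟨fun x => σ (φ x), fun x hx => ?_, fun x hx y hy hxy e => ?_⟩
    · simpa using h1 x hx
    · exact h2 x hx y hy hxy (σ.injective e)
  induction n generalizing L with
  | zero => exact hcol h
  | succ n ih =>
    rcases h with h | ⟨x, hx, h⟩
    · exact Or.inl (hcol h)
    refine Or.inr ⟨x, hx, fun c hc => ?_⟩
    have hc' : σ.symm c ∉ L x := fun hm => hc (by simpa using hm)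
    refine (ih (h _ hc')).mono subset_rfl ?_
    intro y _
    rcases eq_or_ne y x with rfl | hyx
    · simp
    · simp [hyx]

/-- Requester may first play on a subset `S` of the vertices. -/
theorem ReqWins.andThen {S U : Finset V} {L : V → Finset ℕ} {n m : ℕ} (hSU : S ⊆ U)
    (h : ReqWins G S L n)
    (hfin : ∀ L', (∀ x ∉ S, L' x = L x) → ColorableOn G S L' → ReqWins G U L' m) :
    ReqWins G U L (n + m) := by
  induction n generalizing L with
  | zero => exact (hfin L (fun _ _ => rfl) h).of_le (by omega)
  | succ n ih =>
    rcases h with h | ⟨x, hx, h⟩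
    · exact (hfin L (fun _ _ => rfl) h).of_le (by omega)
    have e : n + 1 + m = n + m + 1 := by omega
    rw [e]
    refine Or.inr ⟨x, hSU hx, fun c hc => ih (h c hc) fun L' h1 h2 => hfin L' ?_ h2⟩
    intro y hy
    have hyx : y ≠ x := fun e => hy (e ▸ hx)
    simpa [hyx] using h1 y hy

/-- Requester may first request one color at each vertex of `R`. -/
theorem reqWins_of_request_each {S R : Finset V} {L : V → Finset ℕ} {m : ℕ} (hRS : R ⊆ S)
    (hL : ∀ x ∈ R, L x = ∅)
    (hfin : ∀ L' : V → Finset ℕ, (∀ x ∈ R, ∃ c, L' x = {c}) → (∀ x ∉ R, L' x = L x) →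
      ReqWins G S L' m) :
    ReqWins G S L (m + R.card) := by
  induction R using Finset.induction_on generalizing L with
  | empty => exact hfin L (by simp) (by simp)
  | insert x R hx ih =>
    rw [card_insert_of_notMem hx]
    refine Or.inr ⟨x, hRS (mem_insert_self x R), fun c _ => ih ?_ ?_ ?_⟩
    · exact (subset_insert x R).trans hRS
    · intro y hy
      have hyx : y ≠ x := fun e => hx (e ▸ hy)
      simpa [hyx] using hL y (mem_insert_of_mem hy)
    · intro L' h1 h2
      refine hfin L' (fun y hy => ?_) (fun y hy => ?_)
      · rcases mem_insert.1 hy with rfl | hy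
        · exact ⟨c, by rw [h2 _ hx, hL _ (mem_insert_self _ _)]; simp⟩
        · exact h1 y hy
      · rw [mem_insert, not_or] at hy
        rw [h2 y hy.2, Function.update_of_ne hy.1]

/-- Requester may first request `q` colors at `x`. -/
theorem reqWins_of_request_many {S : Finset V} {L : V → Finset ℕ} {x : V} (hx : x ∈ S) {m : ℕ}
    (q : ℕ) (hfin : ∀ L' : V → Finset ℕ, q ≤ (L' x).card → (∀ y ≠ x, L' y = L y) →
      ReqWins G S L' m) :
    ReqWins G S L (m + q) := by
  suffices H : ∀ p, ∀ L'' : V → Finset ℕ, q ≤ (L'' x).card + p → (∀ y ≠ x, L'' y = L y) →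
      ReqWins G S L'' (m + p) from H q L (by omega) fun _ _ => rfl
  intro p
  induction p with
  | zero => exact fun L'' h1 h2 => hfin L'' h1 h2
  | succ p ih =>
    intro L'' h1 h2
    refine Or.inr ⟨x, hx, fun c hc => ih _ ?_ ?_⟩
    · rw [Function.update_self, card_insert_of_notMem hc]; omega
    · intro y hy
      rw [Function.update_of_ne hy, h2 y hy]

theorem exists_reqWins (G : SimpleGraph V) (S : Finset V) :
    ∃ n, ReqWins G S (fun _ => ∅) n := by
  induction S using Finset.induction_on with
  | empty => exact ⟨0, fun _ => 0, by simp, by simp⟩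
  | insert v S hv ih =>
    obtain ⟨n, hn⟩ := ih
    refine ⟨n + (0 + (S.card + 1)), hn.andThen (subset_insert v S) ?_⟩
    rintro L - ⟨φ, h1, h2⟩
    refine reqWins_of_request_many (mem_insert_self v S) _ fun L' h3 h4 => ?_
    obtain ⟨c, hc, hcS⟩ := exists_mem_notMem_of_card_lt_card
      (lt_of_le_of_lt (card_image_le (s := S) (f := φ)) (Nat.lt_of_succ_le h3))
    have hne : ∀ y ∈ S, y ≠ v := fun y hy e => hv (e ▸ hy)
    have hcS' : ∀ y ∈ S, φ y ≠ c := fun y hy e => hcS (mem_image.2 ⟨y, hy, e⟩)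
    refine ⟨Function.update φ v c, fun x hx => ?_, fun x hx y hy hxy => ?_⟩
    · rcases mem_insert.1 hx with rfl | hx'
      · simpa using hc
      · rw [Function.update_of_ne (hne x hx'), h4 x (hne x hx')]; exact h1 x hx'
    · rw [mem_insert] at hx hy
      rcases hx with rfl | hx <;> rcases hy with rfl | hy
      · exact absurd hxy (G.loopless.irrefl _)
      · rw [Function.update_self, Function.update_of_ne (hne y hy)]; exact (hcS' y hy).symm
      · rw [Function.update_self, Function.update_of_ne (hne x hx)]; exact hcS' x hx
      · rw [Function.update_of_ne (hne y hy), Function.update_of_ne (hne x hx)]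
        exact h2 x hx y hy hxy

theorem reqWins_isc (G : SimpleGraph V) (S : Finset V) : ReqWins G S (fun _ => ∅) (isc G S) :=
  Nat.sInf_mem (s := {n | ReqWins G S (fun _ => ∅) n}) (exists_reqWins G S)

theorem ReqWins.isc_le {S : Finset V} {n : ℕ} (h : ReqWins G S (fun _ => ∅) n) : isc G S ≤ n :=
  Nat.sInf_le (s := {n | ReqWins G S (fun _ => ∅) n}) h

theorem sum_card_update {S : Finset V} {L : V → Finset ℕ} {x : V} {c : ℕ} (hx : x ∈ S)
    (hc : c ∉ L x) :
    ∑ y ∈ S, (Function.update L x (insert c (L x)) y).card = (∑ y ∈ S, (L y).card) + 1 := by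
  rw [← add_sum_erase S _ hx, ← add_sum_erase S (fun y => (L y).card) hx,
    Function.update_self, card_insert_of_notMem hc]
  have : ∑ y ∈ S.erase x, (Function.update L x (insert c (L x)) y).card =
      ∑ y ∈ S.erase x, (L y).card :=
    sum_congr rfl fun y hy => by rw [Function.update_of_ne (ne_of_mem_erase hy)]
  omega

theorem sum_card_update_of_notMem {S : Finset V} {L : V → Finset ℕ} {x : V} {A : Finset ℕ}
    (hx : x ∉ S) : ∑ y ∈ S, (Function.update L x A y).card = ∑ y ∈ S, (L y).card :=
  sum_congr rfl fun y hy => by rw [Function.update_of_ne (ne_of_mem_of_not_mem hy hx)]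

theorem ReqWins.card_le {S : Finset V} {L : V → Finset ℕ} {n : ℕ} (h : ReqWins G S L n) :
    S.card ≤ n + ∑ x ∈ S, (L x).card := by
  have hcol : ∀ {L : V → Finset ℕ}, ColorableOn G S L → S.card ≤ ∑ x ∈ S, (L x).card := by
    rintro L ⟨φ, h1, -⟩
    rw [card_eq_sum_ones]
    exact sum_le_sum fun x hx => card_pos.2 ⟨_, h1 x hx⟩
  induction n generalizing L with
  | zero => simpa using hcol h
  | succ n ih =>
    rcases h with h | ⟨x, hx, h⟩
    · exact (hcol h).trans (Nat.le_add_left _ _)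
    obtain ⟨c, hc⟩ := Infinite.exists_notMem_finset (L x)
    have := ih (h c hc)
    rw [sum_card_update hx hc] at this
    omega

/-- The value of the game on a graph without edges. -/
theorem isc_univ_of_edgeSet_eq_empty (h : G.edgeSet = ∅) : isc G univ = Fintype.card V := by
  refine le_antisymm (ReqWins.isc_le ?_) ?_
  · rw [← card_univ, ← zero_add (card univ)]
    refine reqWins_of_request_each subset_rfl (by simp) fun L h1 _ => ?_
    choose f hf using h1
    refine ⟨fun x => f x (mem_univ x), fun x hx => by simp [hf x hx], fun x _ y _ hxy => ?_⟩
    rw [SimpleGraph.edgeSet_eq_empty] at h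
    simp [h] at hxy
  · simpa using (reqWins_isc G univ).card_le

end Game

/-! ### Color multiplicities on the leaves -/

section Multiplicity

theorem card_filter_notMem_insert (R : Finset V) (a : V → ℕ) (A : Finset ℕ) {c : ℕ} (hc : c ∉ A) :
    (R.filter fun x => a x ∉ insert c A).card + (R.filter fun x => a x = c).card =
      (R.filter fun x => a x ∉ A).card := by
  rw [← card_union_of_disjoint]
  · congr 1
    ext x
    simp only [mem_union, mem_filter, mem_insert, not_or]
    constructor
    · rintro (⟨h, _, h'⟩ | ⟨h, rfl⟩)
      exacts [⟨h, h'⟩, ⟨h, hc⟩]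
    · rintro ⟨h, h'⟩
      by_cases e : a x = c
      · exact Or.inr ⟨h, e⟩
      · exact Or.inl ⟨h, e, h'⟩
  · rw [disjoint_left]
    intro x hx hx'
    simp only [mem_filter, mem_insert, not_or] at hx hx'
    exact absurd hx'.2 hx.2.1

/-- A finset can be colored so that each color class has a prescribed minimum size. -/
theorem exists_fibers_ge (b : ℕ → ℕ) (K : ℕ) (R : Finset V) (h : ∑ i ∈ range K, b i ≤ R.card) :
    ∃ a : V → ℕ, ∀ i < K, b i ≤ (R.filter fun x => a x = i).card := by
  induction K generalizing R with
  | zero => exact ⟨fun _ => 0, by simp⟩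
  | succ K ih =>
    rw [sum_range_succ] at h
    obtain ⟨B, hB, hBc⟩ := exists_subset_card_eq (s := R) (n := b K) (by omega)
    obtain ⟨a, ha⟩ := ih (R \ B) (by rw [card_sdiff_of_subset hB]; omega)
    refine ⟨fun x => if x ∈ B then K else a x, fun i hi => ?_⟩
    rcases Nat.lt_succ_iff_lt_or_eq.1 hi with hi | rfl
    · refine (ha i hi).trans (card_le_card fun x hx => ?_)
      simp only [mem_filter, mem_sdiff] at hx ⊢
      simp [hx.1.1, hx.1.2, hx.2]
    · rw [← hBc]
      refine card_le_card fun x hx => ?_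
      simp [hx, hB hx]

theorem sum_range_sub_eq_tri (k : ℕ) : ∑ i ∈ range k, (k - i) = tri k := by
  induction k with
  | zero => simp [tri_zero]
  | succ k ih =>
    rw [sum_range_succ', tri_succ]
    simpa using ih

end Multiplicity

/-- `R` is a set of leaves attached to `v`, and `v` has at most one neighbor outside `R`. -/
structure IsPendantStar (G : SimpleGraph V) (v : V) (R : Finset V) : Prop where
  notMem : v ∉ R
  adj_center : ∀ x ∈ R, G.Adj v x
  eq_center : ∀ x ∈ R, ∀ y, G.Adj x y → y = v
  unique : ∀ x ∉ R, ∀ y ∉ R, G.Adj v x → G.Adj v y → x = y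

theorem IsStem.isPendantStar {G : SimpleGraph V} {v : V} {R : Finset V} (h : IsStem G v)
    (hR : ∀ w, w ∈ R ↔ (G.Adj v w ∧ IsLeaf G w)) : IsPendantStar G v R where
  notMem hv := G.loopless.irrefl v ((hR v).1 hv).1
  adj_center x hx := ((hR x).1 hx).1
  eq_center x hx y hy := by
    obtain ⟨h1, h2⟩ := (hR x).1 hx
    obtain ⟨z, hz⟩ := Set.ncard_eq_one.1 h2
    have hy' : y ∈ G.neighborSet x := hy
    have hv' : v ∈ G.neighborSet x := h1.symm
    rw [hz] at hy' hv'
    exact hy'.trans hv'.symm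
  unique x hx y hy hvx hvy := by
    refine (Set.ncard_le_one (Set.toFinite _)).1 h.2 x ⟨hvx, fun hl => ?_⟩ y ⟨hvy, fun hl => ?_⟩
    · exact hx ((hR x).2 ⟨hvx, hl⟩)
    · exact hy ((hR y).2 ⟨hvy, hl⟩)

namespace IsPendantStar

variable {G : SimpleGraph V} {v : V} {R : Finset V}

theorem notMem_rest : v ∉ univ \ insert v R := by simp

theorem ne_of_mem_rest {x : V} (hx : x ∈ univ \ insert v R) : x ≠ v := by
  rintro rfl
  simp at hx

theorem notMem_of_mem_rest {x : V} (hx : x ∈ univ \ insert v R) : x ∉ R := by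
  simp only [mem_sdiff, mem_univ, true_and, mem_insert, not_or] at hx
  exact hx.2

theorem mem_rest {x : V} (h1 : x ≠ v) (h2 : x ∉ R) : x ∈ univ \ insert v R := by
  simp [h1, h2]

/-! ### Strategies for Requester -/

theorem colorable_of_rest (hs : IsPendantStar G v R) {L : V → Finset ℕ} {φ : V → ℕ}
    (h1 : ∀ x ∈ univ \ insert v R, φ x ∈ L x)
    (h2 : ∀ x ∈ univ \ insert v R, ∀ y ∈ univ \ insert v R, G.Adj x y → φ x ≠ φ y)
    {c : ℕ} (hc : c ∈ L v) (hcφ : ∀ x ∈ univ \ insert v R, G.Adj v x → φ x ≠ c)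
    (hR : ∀ x ∈ R, ∃ d ∈ L x, d ≠ c) : ColorableOn G univ L := by
  choose! f hf hfc using hR
  have key : ∀ x y, G.Adj x y → (if x = v then c else if x ∈ R then f x else φ x) =
      (if y = v then c else if y ∈ R then f y else φ y) → x ≠ v → False := by
    intro x y hxy e hxv
    rw [if_neg hxv] at e
    by_cases hxR : x ∈ R
    · rw [if_pos hxR, if_pos (hs.eq_center x hxR y hxy)] at e
      exact hfc x hxR e
    rw [if_neg hxR] at e
    by_cases hyv : y = v
    · rw [if_pos hyv] at e
      exact hcφ x (mem_rest hxv hxR) (hyv ▸ hxy.symm) e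
    rw [if_neg hyv] at e
    by_cases hyR : y ∈ R
    · exact hxv (hs.eq_center y hyR x hxy.symm)
    rw [if_neg hyR] at e
    exact h2 x (mem_rest hxv hxR) y (mem_rest hyv hyR) hxy e
  refine ⟨fun x => if x = v then c else if x ∈ R then f x else φ x, fun x _ => ?_,
    fun x _ y _ hxy e => ?_⟩
  · by_cases hxv : x = v
    · simpa [hxv] using hc
    by_cases hxR : x ∈ R
    · simpa [hxv, hxR] using hf x hxR
    · simpa [hxv, hxR] using h1 x (mem_rest hxv hxR)
  · by_cases hxv : x = v
    · exact key y x hxy.symm e.symm fun hyv => G.loopless.irrefl v (by rwa [hxv, hyv] at hxy)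
    · exact key x y hxy e hxv

/-- Requester can finish by requesting a second color at the leaves whose only color is `c`. -/
theorem reqWins_of_choice (hs : IsPendantStar G v R) {L : V → Finset ℕ} {φ : V → ℕ}
    (h1 : ∀ x ∈ univ \ insert v R, φ x ∈ L x)
    (h2 : ∀ x ∈ univ \ insert v R, ∀ y ∈ univ \ insert v R, G.Adj x y → φ x ≠ φ y)
    {c : ℕ} (hc : c ∈ L v) (hcφ : ∀ x ∈ univ \ insert v R, G.Adj v x → φ x ≠ c)
    (hR : ∀ x ∈ R, (L x).Nonempty) {n : ℕ} (hn : (R.filter fun x => L x = {c}).card ≤ n) :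
    ReqWins G univ L n := by
  induction n generalizing L with
  | zero =>
    refine hs.colorable_of_rest h1 h2 hc hcφ fun x hx => ?_
    by_contra! hd
    have hmem : x ∈ R.filter fun x => L x = {c} :=
      mem_filter.2 ⟨hx, eq_singleton_iff_nonempty_unique_mem.2 ⟨hR x hx, hd⟩⟩
    rw [Nat.le_zero, card_eq_zero] at hn
    simp [hn] at hmem
  | succ n ih =>
    by_cases hex : ∃ x ∈ R, L x = {c}
    · obtain ⟨x, hx, hxc⟩ := hex
      refine Or.inr ⟨x, mem_univ x, fun d hd => ?_⟩
      have hxv : v ≠ x := fun e => hs.notMem (e ▸ hx)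
      have hsub : ∀ y, L y ⊆ Function.update L x (insert d (L x)) y := by
        intro y
        rcases eq_or_ne y x with rfl | hyx
        · simp
        · simp [hyx]
      refine ih (fun y hy => hsub y (h1 y hy)) (hsub v hc) (fun y hy => (hR y hy).mono (hsub y)) ?_
      refine Nat.lt_succ_iff.1 (lt_of_lt_of_le (card_lt_card ?_) hn)
      rw [ssubset_iff_of_subset]
      · refine ⟨x, mem_filter.2 ⟨hx, hxc⟩, fun hm => hd ?_⟩
        have hm := (mem_filter.1 hm).2
        rw [Function.update_self] at hm
        rw [hxc, ← hm]
        exact mem_insert_self _ _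
      · intro y hy
        rw [mem_filter] at hy ⊢
        refine ⟨hy.1, ?_⟩
        have := hsub y
        rw [hy.2, subset_singleton_iff] at this
        exact this.resolve_left (hR y hy.1).ne_empty
    · push Not at hex
      refine (ih h1 hc hR ?_ : ReqWins G univ L n).succ
      rw [card_eq_zero.2 (filter_eq_empty_iff.2 hex)]
      exact Nat.zero_le n

/-- The same when every leaf has a single color. -/
theorem reqWins_of_choice_singleton (hs : IsPendantStar G v R) {L : V → Finset ℕ} {φ a : V → ℕ}
    (h1 : ∀ x ∈ univ \ insert v R, φ x ∈ L x)
    (h2 : ∀ x ∈ univ \ insert v R, ∀ y ∈ univ \ insert v R, G.Adj x y → φ x ≠ φ y)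
    {c : ℕ} (hc : c ∈ L v) (hcφ : ∀ x ∈ univ \ insert v R, G.Adj v x → φ x ≠ c)
    (ha : ∀ x ∈ R, L x = {a x}) {n : ℕ} (hn : (R.filter fun x => a x = c).card ≤ n) :
    ReqWins G univ L n := by
  refine hs.reqWins_of_choice h1 h2 hc hcφ (fun x hx => by simp [ha x hx]) ?_
  refine (card_le_card fun x hx => ?_).trans hn
  rw [mem_filter] at hx ⊢
  refine ⟨hx.1, ?_⟩
  have := hx.2
  rwa [ha x hx.1, singleton_inj] at this

/-- Once the rest is colored and the color it forbids at `v` is already in the list of `v`,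
Requester can keep requesting at `v`. -/
theorem reqWins_of_blocked (hs : IsPendantStar G v R) {L : V → Finset ℕ} {φ a : V → ℕ}
    (h1 : ∀ x ∈ univ \ insert v R, φ x ∈ L x)
    (h2 : ∀ x ∈ univ \ insert v R, ∀ y ∈ univ \ insert v R, G.Adj x y → φ x ≠ φ y)
    (hφ : ∀ x ∈ univ \ insert v R, G.Adj v x → φ x ∈ L v)
    (ha : ∀ x ∈ R, L x = {a x}) {n : ℕ} (hn : (R.filter fun x => a x ∉ L v).card < tri n) :
    ReqWins G univ L n := by
  induction n generalizing L with
  | zero => simp [tri_zero] at hn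
  | succ n ih =>
    refine Or.inr ⟨v, mem_univ v, fun c hc => ?_⟩
    have hrest : ∀ x ∈ univ \ insert v R, Function.update L v (insert c (L v)) x = L x :=
      fun x hx => Function.update_of_ne (ne_of_mem_rest hx) _ _
    have h1' : ∀ x ∈ univ \ insert v R, φ x ∈ Function.update L v (insert c (L v)) x :=
      fun x hx => by rw [hrest x hx]; exact h1 x hx
    have ha' : ∀ x ∈ R, Function.update L v (insert c (L v)) x = {a x} := fun x hx => by
      rw [Function.update_of_ne (ne_of_mem_of_not_mem hx hs.notMem), ha x hx]
    have hcard := card_filter_notMem_insert R a (L v) hc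
    by_cases hm : (R.filter fun x => a x = c).card ≤ n
    · refine hs.reqWins_of_choice_singleton h1' h2 (by simp) (fun x hx hvx e => ?_) ha' hm
      exact hc (e ▸ hφ x hx hvx)
    · refine ih h1' (fun x hx hvx => ?_) ha' ?_
      · simpa using Or.inr (hφ x hx hvx)
      · rw [Function.update_self]
        rw [tri_succ] at hn
        omega

/-- The end of the game once the rest is colored: `c` is in the list of `v`, with multiplicity
at most `n` on the leaves. -/
theorem reqWins_of_rest_colorable (hs : IsPendantStar G v R) {L : V → Finset ℕ} {a : V → ℕ}
    (hcol : ColorableOn G (univ \ insert v R) L) (ha : ∀ x ∈ R, L x = {a x}) {c : ℕ}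
    (hc : c ∈ L v) {n : ℕ} (hm : (R.filter fun x => a x = c).card ≤ n)
    (hn : (R.filter fun x => a x ∉ L v).card < tri n) : ReqWins G univ L n := by
  obtain ⟨φ, h1, h2⟩ := hcol
  by_cases hcφ : ∀ x ∈ univ \ insert v R, G.Adj v x → φ x ≠ c
  · exact hs.reqWins_of_choice_singleton h1 h2 hc hcφ ha hm
  · push Not at hcφ
    obtain ⟨x, hx, hvx, hxc⟩ := hcφ
    refine hs.reqWins_of_blocked h1 h2 (fun y hy hvy => ?_) ha hn
    rw [hs.unique y (notMem_of_mem_rest hy) x (notMem_of_mem_rest hx) hvy hvx, hxc]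
    exact hc

/-- The lists `L` with the color `c` removed at the neighbors of `v`. -/
noncomputable def strip (G : SimpleGraph V) (v : V) (c : ℕ) (L : V → Finset ℕ) : V → Finset ℕ :=
  open Classical in fun x => if G.Adj v x then (L x).erase c else L x

theorem mem_strip {c d : ℕ} {L : V → Finset ℕ} {x : V} :
    d ∈ strip G v c L x ↔ d ∈ L x ∧ (G.Adj v x → d ≠ c) := by
  unfold strip
  split_ifs with h <;> simp [h, and_comm]

theorem update_strip_subset {c d : ℕ} {L : V → Finset ℕ} {x : V} (hd : G.Adj v x → d ≠ c) (y : V) :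
    Function.update (strip G v c L) x (insert d (strip G v c L x)) y ⊆
      strip G v c (Function.update L x (insert d (L x))) y := by
  intro e he
  rw [mem_strip]
  rcases eq_or_ne y x with rfl | hyx
  · rw [Function.update_self, mem_insert, mem_strip] at he
    rw [Function.update_self, mem_insert]
    rcases he with rfl | he
    · exact ⟨Or.inl rfl, hd⟩
    · exact ⟨Or.inr he.1, he.2⟩
  · rw [Function.update_of_ne hyx, mem_strip] at he
    rwa [Function.update_of_ne hyx]

/-- Once `c` is in the list of the neighbor of `v`, playing without using `c` there costs
nothing. -/
theorem reqWins_of_strip (hs : IsPendantStar G v R) {L : V → Finset ℕ} {c n m : ℕ} {w : V}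
    (hw : w ∈ univ \ insert v R) (hvw : G.Adj v w) (hcw : c ∈ L w)
    (h : ReqWins G (univ \ insert v R) (strip G v c L) n)
    (hfin : ∀ L' : V → Finset ℕ, (∀ x ∉ univ \ insert v R, L' x = L x) →
      ColorableOn G (univ \ insert v R) (strip G v c L') → ReqWins G univ L' m) :
    ReqWins G univ L (n + m) := by
  induction n generalizing L with
  | zero => exact (hfin L (fun _ _ => rfl) h).of_le (by omega)
  | succ n ih =>
    rcases h with h | ⟨x, hx, h⟩
    · exact (hfin L (fun _ _ => rfl) h).of_le (by omega)
    have e : n + 1 + m = n + m + 1 := by omega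
    rw [e]
    refine Or.inr ⟨x, mem_univ x, fun d hd => ih ?_ ?_ ?_⟩
    · rcases eq_or_ne w x with rfl | hwx
      · simp [hcw]
      · simpa [hwx] using hcw
    · refine (h d fun hd' => hd (mem_strip.1 hd').1).mono subset_rfl fun y _ =>
        update_strip_subset (fun hvx hdc => hd ?_) y
      rw [hs.unique x (notMem_of_mem_rest hx) w (notMem_of_mem_rest hw) hvx hvw, hdc]
      exact hcw
    · intro L' h3 h4
      refine hfin L' (fun y hy => ?_) h4
      rw [h3 y hy, Function.update_of_ne (ne_of_mem_of_not_mem hx hy).symm]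

/-- Forbidding a fixed color at the neighbor of `v` costs at most one extra round. -/
theorem reqWins_of_forbid (hs : IsPendantStar G v R) {L : V → Finset ℕ} {c n m : ℕ}
    (h : ReqWins G (univ \ insert v R) (strip G v c L) n)
    (hfin : ∀ L' : V → Finset ℕ, (∀ x ∉ univ \ insert v R, L' x = L x) →
      ColorableOn G (univ \ insert v R) (strip G v c L') → ReqWins G univ L' m) :
    ReqWins G univ L (n + 1 + m) := by
  induction n generalizing L with
  | zero => exact (hfin L (fun _ _ => rfl) h).of_le (by omega)
  | succ n ih =>
    rcases h with h | ⟨x, hx, h⟩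
    · exact (hfin L (fun _ _ => rfl) h).of_le (by omega)
    have hfin' : ∀ A : Finset ℕ, ∀ L' : V → Finset ℕ,
        (∀ y ∉ univ \ insert v R, L' y = Function.update L x A y) →
        ColorableOn G (univ \ insert v R) (strip G v c L') → ReqWins G univ L' m := by
      intro A L' h3 h4
      refine hfin L' (fun y hy => ?_) h4
      rw [h3 y hy, Function.update_of_ne (ne_of_mem_of_not_mem hx hy).symm]
    have e : n + 1 + 1 + m = n + 1 + m + 1 := by omega
    rw [e]
    refine Or.inr ⟨x, mem_univ x, fun d hd => ?_⟩
    by_cases hdc : G.Adj v x ∧ d = c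
    · obtain ⟨hvx, rfl⟩ := hdc
      have e : n + 1 + m = n + m + 1 := by omega
      rw [e]
      refine Or.inr ⟨x, mem_univ x, fun d' hd' => ?_⟩
      rw [Function.update_self, mem_insert, not_or] at hd'
      rw [Function.update_self, Function.update_idem]
      refine hs.reqWins_of_strip hx hvx (by simp) ?_ (hfin' _)
      refine (h d' fun hm => hd'.2 (mem_strip.1 hm).1).mono subset_rfl fun y _ => ?_
      refine (update_strip_subset (fun _ => hd'.1) y).trans fun b hb => ?_
      rw [mem_strip] at hb ⊢
      refine ⟨?_, hb.2⟩
      rcases eq_or_ne y x with rfl | hyx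
      · simp only [Function.update_self, mem_insert] at hb ⊢
        tauto
      · simpa [hyx] using hb.1
    · refine ih ?_ (hfin' _)
      exact (h d fun hd' => hd (mem_strip.1 hd').1).mono subset_rfl fun y _ =>
        update_strip_subset (fun hvx hdc' => hdc ⟨hvx, hdc'⟩) y

theorem update_center_eq_singleton (hs : IsPendantStar G v R) {L : V → Finset ℕ} {a : V → ℕ}
    (ha : ∀ x ∈ R, L x = {a x}) (A : Finset ℕ) (x : V) (hx : x ∈ R) :
    Function.update L v A x = {a x} := by
  rw [Function.update_of_ne (ne_of_mem_of_not_mem hx hs.notMem), ha x hx]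

theorem update_rest_eq_singleton {L : V → Finset ℕ} {a : V → ℕ}
    (ha : ∀ x ∈ R, L x = {a x}) {y : V} (hy : y ∈ univ \ insert v R) (A : Finset ℕ)
    (x : V) (hx : x ∈ R) : Function.update L y A x = {a x} := by
  rw [Function.update_of_ne (ne_of_mem_of_not_mem hx (notMem_of_mem_rest hy)), ha x hx]

/-- Each leaf has one color, and the rest has not been played yet. -/
theorem reqWins_of_rest (hs : IsPendantStar G v R) {L : V → Finset ℕ} {a : V → ℕ}
    (ha : ∀ x ∈ R, L x = {a x}) (hL : ∀ x ∈ univ \ insert v R, L x = ∅) {N n : ℕ}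
    (hN : ReqWins G (univ \ insert v R) (fun _ => ∅) N)
    (hn : (R.filter fun x => a x ∉ L v).card + 1 < tri n) : ReqWins G univ L (N + n) := by
  induction n generalizing L with
  | zero => simp [tri_zero] at hn
  | succ n ih =>
    refine Or.inr ⟨v, mem_univ v, fun c hc => ?_⟩
    have ha' := hs.update_center_eq_singleton ha (insert c (L v))
    have hcard := card_filter_notMem_insert R a (L v) hc
    rw [tri_succ] at hn
    have hrestore : ∀ {L' : V → Finset ℕ},
        (∀ x ∉ univ \ insert v R, L' x = Function.update L v (insert c (L v)) x) →
        (∀ x ∈ R, L' x = {a x}) ∧ L' v = insert c (L v) := by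
      intro L' h
      refine ⟨fun x hx => ?_, ?_⟩
      · rw [h x fun hx' => notMem_of_mem_rest hx' hx, ha' x hx]
      · rw [h v notMem_rest, Function.update_self]
    rcases Nat.lt_trichotomy (R.filter fun x => a x = c).card n with hm | hm | hm
    · obtain ⟨n, rfl⟩ : ∃ n', n = n' + 1 := ⟨n - 1, by omega⟩
      refine ReqWins.of_le (n := N + 1 + n) ?_ (Nat.add_right_comm N 1 n).le
      refine hs.reqWins_of_forbid (c := c) (hN.mono subset_rfl (by simp)) fun L' h1 h2 => ?_
      obtain ⟨ha'', hv⟩ := hrestore h1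
      obtain ⟨φ, h3, h4⟩ := h2
      refine hs.reqWins_of_choice_singleton (fun x hx => (mem_strip.1 (h3 x hx)).1) h4
        (hv ▸ mem_insert_self _ _) (fun x hx => (mem_strip.1 (h3 x hx)).2) ha'' (by omega)
    · refine (hN.mono (L' := Function.update L v (insert c (L v))) subset_rfl (by simp)).andThen
        (subset_univ _) fun L' h1 h2 => ?_
      obtain ⟨ha'', hv⟩ := hrestore h1
      refine hs.reqWins_of_rest_colorable h2 ha'' (hv ▸ mem_insert_self _ _) hm.le ?_
      rw [hv]
      omega
    · refine ih ha' (fun x hx => ?_) ?_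
      · rw [Function.update_of_ne (ne_of_mem_rest hx), hL x hx]
      · rw [Function.update_self]
        omega

theorem isc_univ_le_of_rest (hs : IsPendantStar G v R) {k : ℕ} (hk : R.card + 1 < tri (k + 1)) :
    isc G univ ≤ isc G (univ \ insert v R) + R.card + 1 + k := by
  refine ReqWins.isc_le ?_
  have e : isc G (univ \ insert v R) + R.card + 1 + k =
    isc G (univ \ insert v R) + (k + 1) + R.card := by omega
  rw [e]
  refine reqWins_of_request_each (subset_univ R) (by simp) fun L h1 h2 => ?_
  choose! a ha using h1
  refine hs.reqWins_of_rest ha (fun x hx => h2 x (notMem_of_mem_rest hx)) (reqWins_isc G _) ?_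
  exact lt_of_le_of_lt (Nat.succ_le_succ (card_filter_le R _)) hk

theorem mem_compl_leaves {x : V} (hx : x ∈ univ \ R) : x = v ∨ x ∈ univ \ insert v R := by
  by_cases h : x = v
  · exact Or.inl h
  · exact Or.inr (mem_rest h (mem_sdiff.1 hx).2)

theorem rest_subset : univ \ insert v R ⊆ univ \ R :=
  sdiff_subset_sdiff subset_rfl (subset_insert v R)

/-- Requester plays on the complement of the leaves as if `c` were the only color supplied
at `v`. -/
theorem reqWins_of_center_singleton (hs : IsPendantStar G v R) {L : V → Finset ℕ} {a : V → ℕ}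
    (ha : ∀ x ∈ R, L x = {a x}) {c n q : ℕ} (hc : c ∈ L v)
    (h : ReqWins G (univ \ R) (Function.update L v {c}) n)
    (hm : (R.filter fun x => a x = c).card ≤ q)
    (hq : (R.filter fun x => a x ∉ L v).card < tri (q + 1)) : ReqWins G univ L (n + q) := by
  have hcol : ∀ {L : V → Finset ℕ}, (∀ x ∈ R, L x = {a x}) → c ∈ L v →
      ColorableOn G (univ \ R) (Function.update L v {c}) → ReqWins G univ L q := by
    rintro L ha hc ⟨φ, h1, h2⟩
    have hv : v ∈ univ \ R := by simpa using hs.notMem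
    have hφv : φ v = c := by simpa using h1 v hv
    refine hs.reqWins_of_choice_singleton (φ := φ) (fun x hx => ?_)
      (fun x hx y hy => h2 x (rest_subset hx) y (rest_subset hy)) hc
      (fun x hx hvx e => h2 v hv x (rest_subset hx) hvx (hφv.trans e.symm)) ha hm
    simpa [ne_of_mem_rest hx] using h1 x (rest_subset hx)
  induction n generalizing L with
  | zero => exact (hcol ha hc h).of_le (by omega)
  | succ n ih =>
    rcases h with h | ⟨x, hx, h⟩
    · exact (hcol ha hc h).of_le (by omega)
    rcases mem_compl_leaves (v := v) hx with rfl | hx'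
    · have hrest : ReqWins G (univ \ insert x R) L n := by
        obtain ⟨d, hd⟩ := Infinite.exists_notMem_finset (Function.update L x {c} x)
        refine (h d hd).mono rest_subset fun y hy => ?_
        simp [ne_of_mem_rest hy]
      have e : n + 1 + q = n + (q + 1) := by omega
      rw [e]
      refine hrest.andThen (subset_univ _) fun L' h1 h2 => ?_
      have hLx : L' x = L x := h1 x notMem_rest
      refine hs.reqWins_of_rest_colorable h2 (fun y hy => ?_) (hLx ▸ hc) (by omega) (hLx ▸ hq)
      rw [h1 y fun hy' => notMem_of_mem_rest hy' hy, ha y hy]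
    · have hxv := ne_of_mem_rest hx'
      have e : n + 1 + q = n + q + 1 := by omega
      rw [e]
      refine Or.inr ⟨x, mem_univ x, fun d hd => ih (update_rest_eq_singleton ha hx' _) ?_ ?_ ?_⟩
      · rwa [Function.update_of_ne hxv.symm]
      · rw [Function.update_comm hxv]
        have := h d (by rwa [Function.update_of_ne hxv])
        rwa [Function.update_of_ne hxv] at this
      · rwa [Function.update_of_ne hxv.symm]

/-- Requester replaces the first request at `v` by repeated requests, until a color with small
multiplicity on the leaves appears. -/
theorem reqWins_of_request_center (hs : IsPendantStar G v R) {L : V → Finset ℕ} {a : V → ℕ}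
    (ha : ∀ x ∈ R, L x = {a x}) {n q : ℕ}
    (h : ∀ c, ReqWins G (univ \ R) (Function.update L v {c}) n)
    (hq : (R.filter fun x => a x ∉ L v).card < tri (q + 1)) :
    ReqWins G univ L (n + q + 1) := by
  induction q generalizing L with
  | zero =>
    refine Or.inr ⟨v, mem_univ v, fun c hc => ?_⟩
    have hcard := card_filter_notMem_insert R a (L v) hc
    have h1 : tri (0 + 1) = 1 := rfl
    refine hs.reqWins_of_center_singleton (q := 0)
      (hs.update_center_eq_singleton ha (insert c (L v))) (c := c) (by simp)
      (by rw [Function.update_idem]; exact h c) (by omega) ?_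
    rw [Function.update_self]
    omega
  | succ q ih =>
    refine Or.inr ⟨v, mem_univ v, fun c hc => ?_⟩
    have hcard := card_filter_notMem_insert R a (L v) hc
    by_cases hm : (R.filter fun x => a x = c).card ≤ q + 1
    · refine hs.reqWins_of_center_singleton
        (hs.update_center_eq_singleton ha (insert c (L v))) (c := c) (by simp)
        (by rw [Function.update_idem]; exact h c) hm ?_
      rw [Function.update_self]
      omega
    · refine ih (hs.update_center_eq_singleton ha _) (fun d => ?_) ?_
      · rw [Function.update_idem]
        exact h d
      · rw [tri_succ (q + 1)] at hq
        rw [Function.update_self]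
        omega

theorem reqWins_of_center_empty (hs : IsPendantStar G v R) {L : V → Finset ℕ} {a : V → ℕ}
    (ha : ∀ x ∈ R, L x = {a x}) (hv : L v = ∅) {n k : ℕ} (h : ReqWins G (univ \ R) L n)
    (hk : R.card < tri (k + 1)) : ReqWins G univ L (n + k) := by
  have hcol : ∀ {L : V → Finset ℕ}, L v = ∅ → ¬ ColorableOn G (univ \ R) L := by
    rintro L hv ⟨φ, h1, -⟩
    have := h1 v (by simpa using hs.notMem)
    simp [hv] at this
  induction n generalizing L with
  | zero => exact absurd h (hcol hv)
  | succ n ih =>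
    rcases h with h | ⟨x, hx, h⟩
    · exact absurd h (hcol hv)
    have e : n + 1 + k = n + k + 1 := by omega
    rw [e]
    rcases mem_compl_leaves (v := v) hx with rfl | hx'
    · refine hs.reqWins_of_request_center ha (fun c => ?_) (by simpa [hv] using hk)
      have := h c (by simp [hv])
      rwa [hv] at this
    · refine Or.inr ⟨x, mem_univ x, fun d hd => ih (update_rest_eq_singleton ha hx' _) ?_ (h d hd)⟩
      rw [Function.update_of_ne (ne_of_mem_rest hx').symm, hv]

theorem isc_univ_le_of_compl_leaves (hs : IsPendantStar G v R) {k : ℕ}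
    (hk : R.card < tri (k + 1)) : isc G univ ≤ isc G (univ \ R) + R.card + k := by
  refine ReqWins.isc_le ?_
  rw [add_right_comm]
  refine reqWins_of_request_each (subset_univ R) (by simp) fun L h1 h2 => ?_
  choose! a ha using h1
  refine hs.reqWins_of_center_empty ha (h2 v hs.notMem) ?_ hk
  exact (reqWins_isc G (univ \ R)).mono subset_rfl (by simp)

/-! ### Strategies for Supplier -/

theorem card_add_card_filter_le {L : V → Finset ℕ} {φ a : V → ℕ} (hs : IsPendantStar G v R)
    (h1 : ∀ x, φ x ∈ L x) (h2 : ∀ x y, G.Adj x y → φ x ≠ φ y)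
    (ha : ∀ x ∈ R, (L x).Nonempty → a x ∈ L x) :
    R.card + (R.filter fun x => a x = φ v).card ≤ ∑ x ∈ R, (L x).card := by
  rw [card_eq_sum_ones, card_filter, ← sum_add_distrib]
  refine sum_le_sum fun x hx => ?_
  split_ifs with hax
  · refine one_lt_card.2 ⟨φ x, h1 x, a x, ha x hx ⟨_, h1 x⟩, ?_⟩
    rw [hax]
    exact (h2 v x (hs.adj_center x hx)).symm
  · exact card_pos.2 ⟨_, h1 x⟩

/-- Supplier can answer a request at `x` by the color `b`, unless it was already supplied. -/
theorem exists_answer (A : Finset ℕ) (b : ℕ) : ∃ c ∉ A, b ∈ insert c A := by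
  by_cases h : b ∈ A
  · obtain ⟨c, hc⟩ := Infinite.exists_notMem_finset A
    exact ⟨c, hc, mem_insert_of_mem h⟩
  · exact ⟨b, h, mem_insert_self _ _⟩

theorem update_answer {L : V → Finset ℕ} {a : V → ℕ} {x : V} {c : ℕ}
    (ha : ∀ y ∈ R, (L y).Nonempty → a y ∈ L y) (hc : x ∈ R → a x ∈ insert c (L x)) (y : V)
    (hy : y ∈ R) (hne : (Function.update L x (insert c (L x)) y).Nonempty) :
    a y ∈ Function.update L x (insert c (L x)) y := by
  rcases eq_or_ne y x with rfl | hyx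
  · rw [Function.update_self]
    exact hc hy
  · rw [Function.update_of_ne hyx] at hne ⊢
    exact ha y hy hne

theorem rest_of_colorable (hs : IsPendantStar G v R) {L : V → Finset ℕ} {a : V → ℕ} {k n s : ℕ}
    (hm : ∀ i < k, k - i ≤ (R.filter fun x => a x = i).card)
    (ha : ∀ x ∈ R, (L x).Nonempty → a x ∈ L x) (hv : L v = range s) (hcol : ColorableOn G univ L) :
    R.card + 1 + k ≤ n + s + ∑ x ∈ R, (L x).card ∧
      ReqWins G (univ \ insert v R) L
        (n + s + ∑ x ∈ R, (L x).card - (R.card + 1 + k)) := by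
  refine ⟨?_, ReqWins.of_colorable (hcol.mono (subset_univ _) fun _ _ => subset_rfl) _⟩
  obtain ⟨φ, h1, h2⟩ := hcol
  have hsum := hs.card_add_card_filter_le (fun x => h1 x (mem_univ x))
    (fun x y => h2 x (mem_univ x) y (mem_univ y)) ha
  have hφ := h1 v (mem_univ v)
  rw [hv, mem_range] at hφ
  by_cases hk : φ v < k
  · have := hm _ hk
    omega
  · omega

/-- Supplier gives the colors `0, 1, …` at `v`, and the color `a x` first at each leaf `x`. -/
theorem rest_of_reqWins (hs : IsPendantStar G v R) {L : V → Finset ℕ} {a : V → ℕ} {k n s : ℕ}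
    (hm : ∀ i < k, k - i ≤ (R.filter fun x => a x = i).card)
    (ha : ∀ x ∈ R, (L x).Nonempty → a x ∈ L x) (hv : L v = range s) (h : ReqWins G univ L n) :
    R.card + 1 + k ≤ n + s + ∑ x ∈ R, (L x).card ∧
      ReqWins G (univ \ insert v R) L
        (n + s + ∑ x ∈ R, (L x).card - (R.card + 1 + k)) := by
  induction n generalizing L s with
  | zero => exact hs.rest_of_colorable hm ha hv h
  | succ n ih =>
    rcases h with h | ⟨x, -, h⟩
    · exact hs.rest_of_colorable hm ha hv h
    by_cases hxv : x = v
    · subst hxv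
      have h' := h s (by simp [hv])
      have := ih (update_answer ha fun hx => absurd hx hs.notMem) (s := s + 1)
        (by rw [Function.update_self, hv, range_add_one]) h'
      rw [sum_card_update_of_notMem hs.notMem] at this
      exact ⟨by omega, (this.2.mono (L' := L) subset_rfl fun y hy => by
        rw [Function.update_of_ne (ne_of_mem_rest hy)]).of_le (by omega)⟩
    by_cases hxR : x ∈ R
    · obtain ⟨c, hc, hac⟩ := exists_answer (L x) (a x)
      have := ih (update_answer ha fun _ => hac) (s := s)
        (by rw [Function.update_of_ne (Ne.symm hxv), hv]) (h c hc)
      rw [sum_card_update hxR hc] at this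
      exact ⟨by omega, (this.2.mono (L' := L) subset_rfl fun y hy => by
        rw [Function.update_of_ne (ne_of_mem_of_not_mem hxR (notMem_of_mem_rest hy)).symm]).of_le
          (by omega)⟩
    · have key := fun c hc => ih (update_answer ha fun hx => absurd hx hxR) (s := s)
        (by rw [Function.update_of_ne (Ne.symm hxv), hv]) (h c hc)
      simp only [sum_card_update_of_notMem hxR] at key
      obtain ⟨c, hc⟩ := Infinite.exists_notMem_finset (L x)
      have hle := (key c hc).1
      refine ⟨by omega, ?_⟩
      have e : n + 1 + s + ∑ x ∈ R, (L x).card - (R.card + 1 + k) =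
        n + s + ∑ x ∈ R, (L x).card - (R.card + 1 + k) + 1 := by omega
      rw [e]
      exact Or.inr ⟨x, mem_rest hxv hxR, fun c hc => (key c hc).2⟩

theorem rest_le_isc_univ (hs : IsPendantStar G v R) {k : ℕ} (hk : tri k ≤ R.card) :
    isc G (univ \ insert v R) + R.card + 1 + k ≤ isc G univ := by
  obtain ⟨a, ha⟩ := exists_fibers_ge (fun i => k - i) k R (by rwa [sum_range_sub_eq_tri])
  obtain ⟨h1, h2⟩ := hs.rest_of_reqWins (s := 0) ha (by simp) (by simp) (reqWins_isc G univ)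
  simp only [card_empty, sum_const_zero] at h1 h2
  have := h2.isc_le
  omega

theorem compl_leaves_of_colorable (hs : IsPendantStar G v R) {L : V → Finset ℕ} {a : V → ℕ}
    {k n s : ℕ} (hm0 : k ≤ (R.filter fun x => a x = 0).card)
    (hm : ∀ i, 1 ≤ i → i ≤ k → k + 1 - i ≤ (R.filter fun x => a x = i).card)
    (ha : ∀ x ∈ R, (L x).Nonempty → a x ∈ L x) (hv : L v = range s) (hcol : ColorableOn G univ L) :
    R.card + k + 1 ≤ n + s + ∑ x ∈ R, (L x).card ∧
      ReqWins G (univ \ R) (Function.update L v {0})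
        (n + s + ∑ x ∈ R, (L x).card - (R.card + k + 1)) := by
  have hvS : v ∈ univ \ R := by simpa using hs.notMem
  obtain ⟨φ, h1, h2⟩ := hcol
  have hsum := hs.card_add_card_filter_le (fun x => h1 x (mem_univ x))
    (fun x y => h2 x (mem_univ x) y (mem_univ y)) ha
  have hφ := h1 v (mem_univ v)
  rw [hv, mem_range] at hφ
  by_cases hs1 : s = 1
  · have hφ0 : φ v = 0 := by omega
    rw [hφ0] at hsum
    refine ⟨by omega, ReqWins.of_colorable ⟨φ, fun x hx => ?_, fun x _ y _ =>
      h2 x (mem_univ x) y (mem_univ y)⟩ _⟩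
    rcases eq_or_ne x v with rfl | hxv
    · simp [hφ0]
    · rw [Function.update_of_ne hxv]
      exact h1 x (mem_univ x)
  · have hle : R.card + k + 2 ≤ s + ∑ x ∈ R, (L x).card := by
      by_cases hφ0 : φ v = 0
      · rw [hφ0] at hsum
        omega
      by_cases hφk : φ v ≤ k
      · have := hm (φ v) (by omega) hφk
        omega
      · omega
    refine ⟨by omega, ?_⟩
    suffices H : ReqWins G (univ \ R) (Function.update L v {0}) 1 from H.of_le (by omega)
    refine Or.inr ⟨v, hvS, fun c hc => ?_⟩
    rw [Function.update_self, mem_singleton] at hc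
    have hd : ∃ d, (d = 0 ∨ d = c) ∧ ∀ y ∈ univ \ R, G.Adj v y → φ y ≠ d := by
      by_contra! H
      obtain ⟨y, hy, hvy, hy0⟩ := H 0 (Or.inl rfl)
      obtain ⟨z, hz, hvz, hzc⟩ := H c (Or.inr rfl)
      rw [hs.unique y (mem_sdiff.1 hy).2 z (mem_sdiff.1 hz).2 hvy hvz, hzc] at hy0
      exact hc hy0
    obtain ⟨d, hdc, hd⟩ := hd
    refine ReqWins.of_colorable ⟨Function.update φ v d, fun x hx => ?_, fun x hx y hy hxy => ?_⟩ _
    · rcases eq_or_ne x v with rfl | hxv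
      · simpa [or_comm] using hdc
      · simpa [hxv] using h1 x (mem_univ x)
    · rcases eq_or_ne x v with rfl | hxv
      · have hyx : y ≠ x := hxy.ne'
        rw [Function.update_self, Function.update_of_ne hyx]
        exact (hd y hy hxy).symm
      rcases eq_or_ne y v with rfl | hyv
      · rw [Function.update_self, Function.update_of_ne hxv]
        exact hd x hx hxy.symm
      · rw [Function.update_of_ne hxv, Function.update_of_ne hyv]
        exact h2 x (mem_univ x) y (mem_univ y) hxy

/-- With the same answers, the game on the complement of the leaves is played as if `0` had
already been supplied at `v`. -/
theorem compl_leaves_of_reqWins (hs : IsPendantStar G v R) {L : V → Finset ℕ} {a : V → ℕ}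
    {k n s : ℕ} (hm0 : k ≤ (R.filter fun x => a x = 0).card)
    (hm : ∀ i, 1 ≤ i → i ≤ k → k + 1 - i ≤ (R.filter fun x => a x = i).card)
    (ha : ∀ x ∈ R, (L x).Nonempty → a x ∈ L x) (hv : L v = range s) (h : ReqWins G univ L n) :
    R.card + k + 1 ≤ n + s + ∑ x ∈ R, (L x).card ∧
      ReqWins G (univ \ R) (Function.update L v {0})
        (n + s + ∑ x ∈ R, (L x).card - (R.card + k + 1)) := by
  induction n generalizing L s with
  | zero => exact hs.compl_leaves_of_colorable hm0 hm ha hv h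
  | succ n ih =>
    rcases h with h | ⟨x, -, h⟩
    · exact hs.compl_leaves_of_colorable hm0 hm ha hv h
    by_cases hxv : x = v
    · subst hxv
      have h' := h s (by simp [hv])
      have := ih (update_answer ha fun hx => absurd hx hs.notMem) (s := s + 1)
        (by rw [Function.update_self, hv, range_add_one]) h'
      rw [sum_card_update_of_notMem hs.notMem, Function.update_idem] at this
      exact ⟨by omega, this.2.of_le (by omega)⟩
    by_cases hxR : x ∈ R
    · obtain ⟨c, hc, hac⟩ := exists_answer (L x) (a x)
      have := ih (update_answer ha fun _ => hac) (s := s)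
        (by rw [Function.update_of_ne (Ne.symm hxv), hv]) (h c hc)
      rw [sum_card_update hxR hc, Function.update_comm hxv] at this
      exact ⟨by omega, (this.2.mono subset_rfl fun y hy => by
        rw [Function.update_of_ne (ne_of_mem_of_not_mem hxR (mem_sdiff.1 hy).2).symm]).of_le
          (by omega)⟩
    · have key := fun c hc => ih (update_answer ha fun hx => absurd hx hxR) (s := s)
        (by rw [Function.update_of_ne (Ne.symm hxv), hv]) (h c hc)
      simp only [sum_card_update_of_notMem hxR, Function.update_comm hxv] at key
      obtain ⟨c, hc⟩ := Infinite.exists_notMem_finset (L x)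
      have hle := (key c hc).1
      refine ⟨by omega, ?_⟩
      have e : n + 1 + s + ∑ x ∈ R, (L x).card - (R.card + k + 1) =
        n + s + ∑ x ∈ R, (L x).card - (R.card + k + 1) + 1 := by omega
      rw [e]
      refine Or.inr ⟨x, by simpa using hxR, fun c hc => ?_⟩
      rw [Function.update_of_ne hxv] at hc ⊢
      exact (key c hc).2

theorem compl_leaves_le_isc_univ (hs : IsPendantStar G v R) {k : ℕ} (hk : k + tri k ≤ R.card) :
    isc G (univ \ R) + R.card + k ≤ isc G univ := by
  obtain ⟨a, ha⟩ := exists_fibers_ge (fun i => if i = 0 then k else k + 1 - i) (k + 1) R (by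
    rw [sum_range_succ']
    simpa [sum_range_sub_eq_tri, add_comm] using hk)
  obtain ⟨h1, h2⟩ := hs.compl_leaves_of_reqWins (k := k) (s := 0) (by simpa using ha 0 (by omega))
    (fun i h1 h2 => by simpa [Nat.one_le_iff_ne_zero.1 h1] using ha i (by omega))
    (by simp) (by simp) (reqWins_isc G univ)
  simp only [card_empty, sum_const_zero] at h1 h2
  have : ReqWins G (univ \ R) (fun _ => ∅)
      (isc G univ + 0 + 0 - (R.card + k + 1) + 1) := by
    refine Or.inr ⟨v, by simpa using hs.notMem, fun c _ => ?_⟩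
    refine (h2.map_perm (Equiv.swap 0 c)).mono subset_rfl fun x _ => ?_
    rcases eq_or_ne x v with rfl | hxv
    · simp
    · simp [hxv]
  have := this.isc_le
  omega

end IsPendantStar

end

/-- Let `T` be a forest. If `T` has no edges, then `χ_ISC(T) = |V(T)|`.  Otherwise, if
`v` is a stem of `T` with set of leaf neighbors `R` and `r = |R|`, then
`χ_ISC(T) = χ_ISC(T - R - v) + r + 1 + u_r` when `r + 1` is not triangular, and
`χ_ISC(T) = χ_ISC(T - R) + r + u_r` when `r + 1` is triangular. -/
theorem stmt13 (G : SimpleGraph V) (hG : G.IsAcyclic) :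
    (G.edgeSet = ∅ → isc G Finset.univ = Fintype.card V) ∧
    (∀ (v : V) (R : Finset V), IsStem G v →
      (∀ w, w ∈ R ↔ (G.Adj v w ∧ IsLeaf G w)) →
      ((¬ IsTriangular (R.card + 1) →
          isc G Finset.univ =
            isc G (Finset.univ \ insert v R) + R.card + 1 + uval R.card) ∧
        (IsTriangular (R.card + 1) →
          isc G Finset.univ = isc G (Finset.univ \ R) + R.card + uval R.card))) := by
  refine ⟨isc_univ_of_edgeSet_eq_empty, fun v R hv hR => ?_⟩
  have hs := hv.isPendantStar hR
  have h1 := tri_uval_le R.card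
  have h2 := lt_tri_uval_succ R.card
  rw [isTriangular_succ_iff]
  refine ⟨fun h => le_antisymm (hs.isc_univ_le_of_rest (by omega)) (hs.rest_le_isc_univ h1),
    fun h => le_antisymm (hs.isc_univ_le_of_compl_leaves h2) (hs.compl_leaves_le_isc_univ ?_)⟩
  rw [tri_succ] at h
  omega
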